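/- Let G be a DAG and let S ⊆ E(G) be a matching of reversible edges of G, i.e., a set of reversible edges whose endpoint sets are pairwise disjoint. Then the Markov equivalence class of G has size at least 2^{|S|}. -/

import Mathlib

namespace CausalMEC

/-- A directed graph on `Fin n`, given by a Boolean edge function (`d a b = true` means `a → b`). -/
abbrev Dir (n : ℕ) := Fin n → Fin n → Bool

/-- Directed reachability (zero or more steps). -/
def Reach {n : ℕ} (d : Dir n) : Fin n → Fin n → Prop :=
  Relation.ReflTransGen fun a b => d a b = true

/-- No directed cycles (including no self-loops). -/
def Acyclic {n : ℕ} (d : Dir n) : Prop :=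
  ∀ v, ¬ Relation.TransGen (fun a b => d a b = true) v v

/-- A directed acyclic graph. -/
def IsDAG {n : ℕ} (d : Dir n) : Prop :=
  (∀ v, d v v = false) ∧ Acyclic d

/-- A directed (possibly cyclic) graph with edges between distinct vertices. -/
def IsDCG {n : ℕ} (d : Dir n) : Prop :=
  ∀ v, d v v = false

/-- The number of directed edges. -/
def edgeCount {n : ℕ} (d : Dir n) : ℕ :=
  (Finset.univ.filter fun q : Fin n × Fin n => d q.1 q.2 = true).card

/-- The parent set of a vertex. -/
def parents {n : ℕ} (d : Dir n) (v : Fin n) : Finset (Fin n) :=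
  Finset.univ.filter fun u => d u v = true

/-! ### Paths, d-connection and Markov equivalence in mixed graphs
A mixed graph is given by a directed part `d` and a bidirected part `b`. -/

/-- The kind of a step on a path: a directed edge traversed forwards, a directed edge
traversed backwards, or a bidirected edge. -/
inductive EdgeKind : Type
  | fwd | bwd | bidir
deriving DecidableEq

/-- Does the step point into its second endpoint? -/
def EdgeKind.intoSnd : EdgeKind → Bool
  | .fwd => true
  | .bwd => false
  | .bidir => true

/-- Does the step point into its first endpoint? -/
def EdgeKind.intoFst : EdgeKind → Bool
  | .fwd => false
  | .bwd => true
  | .bidir => true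

/-- A (possibly self-intersecting) path from `u` to `v` in the mixed graph `(d, b)`. -/
structure MPath {n : ℕ} (d b : Dir n) (u v : Fin n) where
  len : ℕ
  vert : Fin (len + 1) → Fin n
  kind : Fin len → EdgeKind
  first_eq : vert 0 = u
  last_eq : vert (Fin.last len) = v
  valid : ∀ i : Fin len,
    (kind i = .fwd → d (vert i.castSucc) (vert i.succ) = true) ∧
    (kind i = .bwd → d (vert i.succ) (vert i.castSucc) = true) ∧
    (kind i = .bidir → b (vert i.castSucc) (vert i.succ) = true)

/-- Whether the internal vertex at position `i` of a path is a collider. -/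
def MPath.colliderAt {n : ℕ} {d b : Dir n} {u v : Fin n} (π : MPath d b u v)
    (i : ℕ) (h1 : 0 < i) (h2 : i < π.len) : Bool :=
  (π.kind ⟨i - 1, by omega⟩).intoSnd && (π.kind ⟨i, h2⟩).intoFst

/-- A path is active given a conditioning set `Z` if every non-collider on it avoids `Z`
and every collider on it is in `Z` or has a descendant in `Z`. -/
def MPath.Active {n : ℕ} {d b : Dir n} {u v : Fin n} (π : MPath d b u v)
    (Z : Finset (Fin n)) : Prop :=
  ∀ (i : ℕ) (h1 : 0 < i) (h2 : i < π.len),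
    (π.colliderAt i h1 h2 = true →
      ∃ x ∈ Z, Reach d (π.vert ⟨i, by omega⟩) x) ∧
    (π.colliderAt i h1 h2 = false →
      π.vert ⟨i, by omega⟩ ∉ Z)

/-- d-connection given a conditioning set. -/
def DConn {n : ℕ} (d b : Dir n) (u v : Fin n) (Z : Finset (Fin n)) : Prop :=
  ∃ π : MPath d b u v, π.Active Z

/-- Markov equivalence of two mixed graphs: the same d-connection relations. -/
def MarkovEquiv {n : ℕ} (d b d' b' : Dir n) : Prop :=
  ∀ (u v : Fin n) (Z : Finset (Fin n)), u ≠ v → u ∉ Z → v ∉ Z →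
    (DConn d b u v Z ↔ DConn d' b' u v Z)

/-- The empty bidirected part: a purely directed graph. -/
def noBi (n : ℕ) : Dir n := fun _ _ => false

/-- Markov equivalence for purely directed graphs. -/
def MarkovEquivD {n : ℕ} (d d' : Dir n) : Prop :=
  MarkovEquiv d (noBi n) d' (noBi n)

/-- The Markov equivalence class of a DAG (within DAGs). -/
def MECdag {n : ℕ} (d : Dir n) : Set (Dir n) :=
  {d' | IsDAG d' ∧ MarkovEquivD d d'}

/-- An acyclic directed mixed graph. -/
def IsADMG {n : ℕ} (d b : Dir n) : Prop :=
  IsDAG d ∧ (∀ v w, b v w = b w v) ∧ (∀ v, b v v = false)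

/-- The Markov equivalence class of an ADMG (within ADMGs). -/
def MECadmg {n : ℕ} (d b : Dir n) : Set (Dir n × Dir n) :=
  {G | IsADMG G.1 G.2 ∧ MarkovEquiv d b G.1 G.2}

/-- The Markov equivalence class of a DCG (within DCGs). -/
def MECdcg {n : ℕ} (d : Dir n) : Set (Dir n) :=
  {d' | IsDCG d' ∧ MarkovEquivD d d'}

/-! ### The distribution `D(n,p)` and uniform ADMGs/DCGs -/

/-- The (unnormalized) weight of a DAG under `D(n,p)`. -/
noncomputable def dagWeight {n : ℕ} (p : ℝ) (d : Dir n) : ℝ :=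
  (p / (1 - p)) ^ edgeCount d

open scoped Classical in
/-- Probability of the event `A` under `D(n,p)`. -/
noncomputable def prD (n : ℕ) (p : ℝ) (A : Dir n → Prop) : ℝ :=
  (∑ d : Dir n, if IsDAG d ∧ A d then dagWeight p d else 0) /
    (∑ d : Dir n, if IsDAG d then dagWeight p d else 0)

open scoped Classical in
/-- Expectation of `f` under `D(n,p)`. -/
noncomputable def expD (n : ℕ) (p : ℝ) (f : Dir n → ℝ) : ℝ :=
  (∑ d : Dir n, if IsDAG d then f d * dagWeight p d else 0) /
    (∑ d : Dir n, if IsDAG d then dagWeight p d else 0)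

/-- Conditional probability of `A` given `B` under `D(n,p)`. -/
noncomputable def condPrD (n : ℕ) (p : ℝ) (A B : Dir n → Prop) : ℝ :=
  prD n p (fun d => A d ∧ B d) / prD n p B

open scoped Classical in
/-- Expectation of `f` under the uniform distribution on ADMGs on `n` vertices. -/
noncomputable def expADMG (n : ℕ) (f : Dir n × Dir n → ℝ) : ℝ :=
  (∑ G : Dir n × Dir n, if IsADMG G.1 G.2 then f G else 0) /
    (∑ G : Dir n × Dir n, if IsADMG G.1 G.2 then (1 : ℝ) else 0)

open scoped Classical in
/-- Expectation of `f` under the uniform distribution on DCGs on `n` vertices. -/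
noncomputable def expDCG (n : ℕ) (f : Dir n → ℝ) : ℝ :=
  (∑ d : Dir n, if IsDCG d then f d else 0) /
    (∑ d : Dir n, if IsDCG d then (1 : ℝ) else 0)

open scoped Classical in
/-- Probability of the event `A` under the uniform distribution on DCGs on `n` vertices. -/
noncomputable def prDCG (n : ℕ) (A : Dir n → Prop) : ℝ :=
  (∑ d : Dir n, if IsDCG d ∧ A d then (1 : ℝ) else 0) /
    (∑ d : Dir n, if IsDCG d then (1 : ℝ) else 0)

/-! ### Tower decomposition -/

/-- The sources of `d` within a vertex set `S` (no parents inside `S`). -/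
def sourcesIn {n : ℕ} (d : Dir n) (S : Finset (Fin n)) : Finset (Fin n) :=
  S.filter fun v => ∀ u ∈ S, d u v = false

/-- The vertices remaining after peeling off `k` layers of sources. -/
def remaining {n : ℕ} (d : Dir n) : ℕ → Finset (Fin n)
  | 0 => Finset.univ
  | k + 1 => remaining d k \ sourcesIn d (remaining d k)

/-- The `i`-th layer (1-based) of the tower decomposition of `d`. -/
def towerLayer {n : ℕ} (d : Dir n) (i : ℕ) : Finset (Fin n) :=
  sourcesIn d (remaining d (i - 1))

/-- The 1-based index of the layer containing `v`. -/
def layerIdx {n : ℕ} (d : Dir n) (v : Fin n) : ℕ :=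
  ((Finset.range n).filter fun j => v ∈ remaining d j).card

/-- The tower of a DAG: only the edges between adjacent layers are kept. -/
def tower {n : ℕ} (d : Dir n) : Dir n :=
  fun a c => d a c && decide (layerIdx d c = layerIdx d a + 1)

/-- `h` is the tower vector of `d` (layer sizes, 1-based, and no further layers). -/
def hasTowerVector {n : ℕ} (d : Dir n) (h : List ℕ) : Prop :=
  (∀ i : Fin h.length, (towerLayer d (i.val + 1)).card = h.get i) ∧
    towerLayer d (h.length + 1) = ∅

/-- `H` is the tower decomposition of `d`. -/
def hasTowerDecomp {n : ℕ} (d : Dir n) (H : List (Finset (Fin n))) : Prop :=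
  (∀ i : Fin H.length, towerLayer d (i.val + 1) = H.get i) ∧
    towerLayer d (H.length + 1) = ∅

/-- The weight `w(h)` of a tower vector `h = (h_1, …, h_s)`. -/
noncomputable def towerWeight (p : ℝ) (h : List ℕ) : ℝ :=
  (Nat.multinomial Finset.univ (fun i : Fin h.length => h.get i) : ℝ) *
    ∏ k ∈ Finset.Icc 2 h.length,
      (1 - (1 - p) ^ h.getD (k - 2) 0) ^ h.getD (k - 1) 0 /
        (1 - p) ^ (h.getD (k - 1) 0 * ∑ i ∈ Finset.range (k - 1), h.getD i 0)

/-! ### Edge reversal and deletion -/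

/-- Reverse the edge `v → w`. -/
def reverseEdge {n : ℕ} (d : Dir n) (v w : Fin n) : Dir n :=
  fun a c => if a = v ∧ c = w then false else if a = w ∧ c = v then true else d a c

/-- Delete the edge `v → w`. -/
def deleteEdge {n : ℕ} (d : Dir n) (v w : Fin n) : Dir n :=
  fun a c => if a = v ∧ c = w then false else d a c

/-- The edge `v → w` of a DAG is reversible: reversing it yields a Markov-equivalent DAG. -/
def Reversible {n : ℕ} (d : Dir n) (v w : Fin n) : Prop :=
  d v w = true ∧ IsDAG (reverseEdge d v w) ∧ MarkovEquivD d (reverseEdge d v w)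

/-- `d` has a matching of reversible layer-2-edges of size at least `m`. -/
def hasRevL2Matching {n : ℕ} (d : Dir n) (m : ℝ) : Prop :=
  ∃ S : Finset (Fin n × Fin n),
    (∀ e ∈ S, Reversible d e.1 e.2 ∧ e.2 ∈ towerLayer d 2) ∧
    (∀ e ∈ S, ∀ e' ∈ S, e ≠ e' →
      e.1 ≠ e'.1 ∧ e.1 ≠ e'.2 ∧ e.2 ≠ e'.1 ∧ e.2 ≠ e'.2) ∧
    m ≤ (S.card : ℝ)

/-! ### Cycles and the `Reverse` construction -/

/-- Cyclic successor in `Fin k`. -/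
def cycSucc {k : ℕ} (i : Fin k) : Fin k :=
  ⟨(i.val + 1) % k, Nat.mod_lt _ i.pos⟩

/-- The reversed parametrization of a cycle. -/
def cycRev {n k : ℕ} (c : Fin k → Fin n) : Fin k → Fin n :=
  fun i => c ⟨(k - i.val) % k, Nat.mod_lt _ i.pos⟩

/-- `c` lists the (distinct) vertices of a directed cycle of `d`, in order. -/
def IsCycle {n k : ℕ} (d : Dir n) (c : Fin k → Fin n) : Prop :=
  Function.Injective c ∧ ∀ i, d (c i) (c (cycSucc i)) = true

/-- The `Reverse(G, C)` construction: reverse the cycle `c` and redirect every edge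
`w → v_i` with `w ∈ Pa(v_i) \ {v_{i-1}}` to `w → v_{i-1}`. -/
def reverseCycle {n k : ℕ} (d : Dir n) (c : Fin k → Fin n) : Dir n :=
  fun a e =>
    decide ((∃ j : Fin k, e = c j ∧
        (a = c (cycSucc j) ∨ (d a (c (cycSucc j)) = true ∧ a ≠ c j))) ∨
      ((∀ j : Fin k, e ≠ c j) ∧ d a e = true))

/-- A vertex triple induces exactly a directed 3-cycle. -/
def induces3Cycle {n : ℕ} (d : Dir n) (W : Finset (Fin n)) : Prop :=
  ∃ a b c : Fin n, W = {a, b, c} ∧ a ≠ b ∧ a ≠ c ∧ b ≠ c ∧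
    d a b = true ∧ d b c = true ∧ d c a = true ∧
    d b a = false ∧ d c b = false ∧ d a c = false

/-! ### d-connection as reachability

A state `(x, p)` records the current vertex of a walk and whether the last edge traversed points
into it. -/

/-- One step of a walk all of whose colliders lie in `Z` and whose non-colliders avoid `Z`. -/
def WalkStep {n : ℕ} (d : Dir n) (Z : Finset (Fin n)) (s t : Fin n × Bool) : Prop :=
  (t.2 = true ∧ s.1 ∉ Z ∧ d s.1 t.1 = true) ∨
    (t.2 = false ∧ (s.1 ∈ Z ↔ s.2 = true) ∧ d t.1 s.1 = true)

/-- Reachability of a state by such walks starting at `u`. -/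
def WalkReach {n : ℕ} (d : Dir n) (Z : Finset (Fin n)) (u : Fin n) (s : Fin n × Bool) : Prop :=
  Relation.ReflTransGen (WalkStep d Z) (u, false) s

theorem WalkReach.fwd {n : ℕ} {d : Dir n} {Z : Finset (Fin n)} {u x y : Fin n} {p : Bool}
    (h : WalkReach d Z u (x, p)) (hx : x ∉ Z) (hxy : d x y = true) :
    WalkReach d Z u (y, true) :=
  h.tail (Or.inl ⟨rfl, hx, hxy⟩)

theorem WalkReach.bwd {n : ℕ} {d : Dir n} {Z : Finset (Fin n)} {u x y : Fin n} {p : Bool}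
    (h : WalkReach d Z u (x, p)) (hx : x ∈ Z ↔ p = true) (hyx : d y x = true) :
    WalkReach d Z u (y, false) :=
  h.tail (Or.inr ⟨rfl, hx, hyx⟩)

/-- A walk that arrives at a vertex with a descendant in `Z` can descend to `Z` and come back. -/
theorem WalkReach.bounce {n : ℕ} {d : Dir n} {Z : Finset (Fin n)} {u y x : Fin n}
    (hyx : Reach d y x) (hx : x ∈ Z) (h : WalkReach d Z u (y, true)) :
    y ∈ Z ∨ WalkReach d Z u (y, false) := by
  induction hyx using Relation.ReflTransGen.head_induction_on with
  | refl => exact Or.inl hx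
  | @head a c hac _ ih =>
    by_cases ha : a ∈ Z
    · exact Or.inl ha
    right
    have hc := h.fwd ha hac
    by_cases hcZ : c ∈ Z
    · exact hc.bwd (by simp [hcZ]) hac
    · exact ((ih hc).resolve_left hcZ).bwd (by simp [hcZ]) hac

theorem DConn.exists_walkReach {n : ℕ} {d : Dir n} {Z : Finset (Fin n)} {u v : Fin n}
    (hu : u ∉ Z) (h : DConn d (noBi n) u v Z) : ∃ p, WalkReach d Z u (v, p) := by
  obtain ⟨π, hπ⟩ := h
  have key : ∀ (i : ℕ) (hi : i < π.len),
      WalkReach d Z u (π.vert ⟨i + 1, by omega⟩, (π.kind ⟨i, hi⟩).intoSnd) := by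
    intro i
    induction i with
    | zero =>
      intro hi
      have h0 : WalkReach d Z u (π.vert ⟨0, by omega⟩, false) := by
        have : π.vert ⟨0, by omega⟩ = u := π.first_eq
        rw [this]
        exact Relation.ReflTransGen.refl
      have hu' : π.vert ⟨0, by omega⟩ ∉ Z := by
        have : π.vert ⟨0, by omega⟩ = u := π.first_eq
        rwa [this]
      obtain ⟨hf, hb, hbi⟩ := π.valid ⟨0, hi⟩
      cases hk : π.kind ⟨0, hi⟩ with
      | fwd => exact h0.fwd hu' (hf hk)
      | bwd => exact h0.bwd (iff_of_false hu' (by simp)) (hb hk)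
      | bidir => simp [noBi, hk] at hbi
    | succ i ih =>
      intro hi
      have hprev := ih (by omega)
      obtain ⟨hcol, hnon⟩ := hπ (i + 1) (by omega) hi
      obtain ⟨hf, hb, hbi⟩ := π.valid ⟨i + 1, hi⟩
      simp only [MPath.colliderAt, Nat.add_sub_cancel] at hcol hnon
      cases hk : π.kind ⟨i + 1, hi⟩ with
      | fwd =>
        exact hprev.fwd (hnon (by simp [hk, EdgeKind.intoFst])) (hf hk)
      | bwd =>
        cases hp : (π.kind ⟨i, by omega⟩).intoSnd with
        | false =>
          have hZ := hnon (by simp [hp])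
          rw [hp] at hprev
          exact hprev.bwd (by simp [hZ]) (hb hk)
        | true =>
          obtain ⟨x, hx, hreach⟩ := hcol (by simp [hk, hp, EdgeKind.intoFst])
          rw [hp] at hprev
          by_cases hZ : π.vert ⟨i + 1, by omega⟩ ∈ Z
          · exact hprev.bwd (by simp [hZ]) (hb hk)
          · exact ((WalkReach.bounce hreach hx hprev).resolve_left hZ).bwd (by simp [hZ]) (hb hk)
      | bidir => simp [noBi, hk] at hbi
  rcases Nat.eq_zero_or_pos π.len with h0 | hpos
  · have : v = u := by
      refine π.last_eq.symm.trans (Eq.trans (congrArg π.vert ?_) π.first_eq)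
      exact Fin.ext h0
    exact ⟨false, this ▸ Relation.ReflTransGen.refl⟩
  · have := key (π.len - 1) (by omega)
    have hlast : π.vert ⟨π.len - 1 + 1, by omega⟩ = v := by
      refine Eq.trans (congrArg π.vert (Fin.ext ?_)) π.last_eq
      exact Nat.sub_add_cancel hpos
    rw [hlast] at this
    exact ⟨_, this⟩

theorem WalkReach.exists_seq {n : ℕ} {d : Dir n} {Z : Finset (Fin n)} {u : Fin n}
    {s : Fin n × Bool} (h : WalkReach d Z u s) :
    ∃ (L : ℕ) (f : ℕ → Fin n × Bool), f 0 = (u, false) ∧ f L = s ∧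
      ∀ i < L, WalkStep d Z (f i) (f (i + 1)) := by
  induction h with
  | refl => exact ⟨0, fun _ => (u, false), rfl, rfl, by simp⟩
  | @tail b c _ hbc ih =>
    obtain ⟨L, f, h0, hL, hs⟩ := ih
    refine ⟨L + 1, fun i => if i ≤ L then f i else c, by simp [h0], by simp, fun i hi => ?_⟩
    rcases Nat.lt_succ_iff_lt_or_eq.mp hi with h | rfl
    · simpa [h.le, Nat.succ_le_iff.mpr h] using hs i h
    · simpa [hL] using hbc

theorem WalkReach.dConn {n : ℕ} {d : Dir n} {Z : Finset (Fin n)} {u v : Fin n} {p : Bool}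
    (h : WalkReach d Z u (v, p)) : DConn d (noBi n) u v Z := by
  obtain ⟨L, f, h0, hL, hs⟩ := h.exists_seq
  refine ⟨⟨L, fun i => (f i).1, fun i => if (f (i + 1)).2 then .fwd else .bwd, by simp [h0],
    by simp [hL], fun i => ?_⟩, fun i h1 h2 => ?_⟩
  · have := hs i i.2
    cases hb : (f (i + 1)).2 <;> simp_all [WalkStep]
  · obtain ⟨j, rfl⟩ : ∃ j, i = j + 1 := ⟨i - 1, by omega⟩
    have := hs (j + 1) h2
    simp only [MPath.colliderAt, Nat.add_sub_cancel]
    cases hb : (f (j + 1)).2 <;> cases hb' : (f (j + 1 + 1)).2 <;>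
      simp_all [WalkStep, EdgeKind.intoSnd, EdgeKind.intoFst]
    exact ⟨_, this.1, Relation.ReflTransGen.refl⟩

theorem dConn_iff_exists_walkReach {n : ℕ} {d : Dir n} {Z : Finset (Fin n)} {u v : Fin n}
    (hu : u ∉ Z) : DConn d (noBi n) u v Z ↔ ∃ p, WalkReach d Z u (v, p) :=
  ⟨fun h => h.exists_walkReach hu, fun ⟨_, h⟩ => h.dConn⟩

/-! ### Reversible edges are covered -/

/-- The edge `v → w` is covered: apart from `v` itself, `w` has the same parents as `v`. -/
structure Covered {n : ℕ} (d : Dir n) (v w : Fin n) : Prop where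
  ne : v ≠ w
  edge : d v w = true
  not_edge : d w v = false
  parents_eq : ∀ x, x ≠ v → x ≠ w → d x w = d x v

/-- The local Markov property: a vertex is d-separated from its non-descendants by its parents. -/
theorem not_dConn_parents {n : ℕ} {d : Dir n} (hd : IsDAG d) {v x : Fin n} (hxv : x ≠ v)
    (hpar : d x v = false) (hdesc : ¬ Reach d v x) :
    ¬ DConn d (noBi n) v x (parents d v) := by
  intro h
  obtain ⟨p, hp⟩ := h.exists_walkReach (by simp [parents, hd.1])
  have key : ∀ s, WalkReach d (parents d v) v s →
      (s.2 = true ∧ Reach d v s.1) ∨ s = (v, false) ∨ (s.2 = false ∧ d s.1 v = true) := by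
    intro s hs
    induction hs with
    | refl => simp
    | @tail b c _ hbc ih =>
      rcases hbc with ⟨hc, hb, hbc⟩ | ⟨hc, hb, hcb⟩
      · rcases ih with ⟨_, hr⟩ | rfl | ⟨_, hbv⟩
        · exact Or.inl ⟨hc, hr.tail hbc⟩
        · exact Or.inl ⟨hc, Relation.ReflTransGen.single hbc⟩
        · simp [parents, hbv] at hb
      · rcases ih with ⟨hb2, hr⟩ | rfl | ⟨hb2, hbv⟩
        · have hbv : d b.1 v = true := by simpa [parents, hb2] using hb
          exact (hd.2 v (Relation.TransGen.tail' hr hbv)).elim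
        · exact Or.inr (Or.inr ⟨hc, hcb⟩)
        · simp [parents, hbv, hb2] at hb
  rcases key _ hp with ⟨_, hr⟩ | h | ⟨_, h⟩
  · exact hdesc hr
  · exact hxv (Prod.ext_iff.mp h).1
  · simp [hpar] at h

/-- A collider `x → w ← v` cannot become a chain `x → w → v` with `x`, `v` non-adjacent in a Markov
equivalent DAG. -/
theorem MarkovEquivD.edge_of_collider {n : ℕ} {d d' : Dir n} (hd' : IsDAG d')
    (h : MarkovEquivD d d') {v w x : Fin n} (hxv : x ≠ v) (hdx : d x w = true)
    (hdv : d v w = true) (hxw : d' x w = true) (hwv : d' w v = true) : d' x v = true := by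
  by_contra hpar
  rw [Bool.not_eq_true] at hpar
  have hvZ : v ∉ parents d' v := by simp [parents, hd'.1]
  have hxZ : x ∉ parents d' v := by simp [parents, hpar]
  have hwZ : w ∈ parents d' v := by simp [parents, hwv]
  refine not_dConn_parents hd' hxv hpar (fun hr => hd'.2 v ?_)
    ((h v x (parents d' v) hxv.symm hvZ hxZ).mp ?_)
  · exact ((Relation.TransGen.tail' hr hxw).tail hwv)
  · have h0 : WalkReach d (parents d' v) v (v, false) := Relation.ReflTransGen.refl
    exact ((h0.fwd hvZ hdv).bwd (by simp [hwZ]) hdx).dConn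

theorem IsDAG.not_edge {n : ℕ} {d : Dir n} (hd : IsDAG d) {a c : Fin n} (h : Reach d a c) :
    d c a = false := by
  by_contra hca
  exact hd.2 a (Relation.TransGen.tail' h (by simpa using hca))

theorem MarkovEquivD.symm {n : ℕ} {d d' : Dir n} (h : MarkovEquivD d d') : MarkovEquivD d' d :=
  fun u v Z huv hu hv => (h u v Z huv hu hv).symm

theorem MarkovEquivD.trans {n : ℕ} {d d' d'' : Dir n} (h : MarkovEquivD d d')
    (h' : MarkovEquivD d' d'') : MarkovEquivD d d'' :=
  fun u v Z huv hu hv => (h u v Z huv hu hv).trans (h' u v Z huv hu hv)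

theorem Reversible.covered {n : ℕ} {d : Dir n} (hd : IsDAG d) {v w : Fin n}
    (h : Reversible d v w) : Covered d v w := by
  obtain ⟨hvw, hd', hm⟩ := h
  have hne : v ≠ w := by
    rintro rfl
    simp [hd.1] at hvw
  have hrev : reverseEdge d v w w v = true := by simp [reverseEdge, hne]
  refine ⟨hne, hvw, hd.not_edge (.single hvw), fun x hxv hxw => ?_⟩
  have hx : reverseEdge d v w x w = d x w := by simp [reverseEdge, hxv, hxw]
  have hx' : reverseEdge d v w x v = d x v := by simp [reverseEdge, hxv, hxw]
  rw [Bool.eq_iff_iff]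
  constructor <;> intro h
  · rw [← hx']
    exact hm.edge_of_collider hd' hxv h hvw (hx.trans h) hrev
  · exact hm.symm.edge_of_collider hd hxw (hx'.trans h) hrev h hvw

/-! ### Reversing a covered edge -/

theorem Covered.reverseEdge {n : ℕ} {d : Dir n} {v w : Fin n} (h : Covered d v w) :
    Covered (reverseEdge d v w) w v := by
  have hne := h.ne
  refine ⟨hne.symm, by simp [CausalMEC.reverseEdge, hne], by simp [CausalMEC.reverseEdge],
    fun x hxw hxv => ?_⟩
  simp [CausalMEC.reverseEdge, hxw, hxv, h.parents_eq x hxv hxw]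

theorem Covered.reverseEdge_reverseEdge {n : ℕ} {d : Dir n} {v w : Fin n} (h : Covered d v w) :
    CausalMEC.reverseEdge (CausalMEC.reverseEdge d v w) w v = d := by
  have := h.edge
  have := h.not_edge
  have := h.ne
  funext a c
  simp only [CausalMEC.reverseEdge]
  grind

/-- Acyclicity is witnessed by a ranking of the vertices that increases along edges. -/
theorem isDAG_iff_exists_rank {n : ℕ} {d : Dir n} :
    IsDAG d ↔ ∃ r : Fin n → ℕ, ∀ a c, d a c = true → r a < r c := by
  classical
  constructor
  · intro hd
    refine ⟨fun x => (Finset.univ.filter fun y =>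
      Relation.TransGen (fun a b => d a b = true) y x).card, fun a c hac => ?_⟩
    refine Finset.card_lt_card (Finset.ssubset_iff_of_subset ?_ |>.mpr ⟨a, ?_, ?_⟩)
    · intro y hy
      simp only [Finset.mem_filter, Finset.mem_univ, true_and] at hy ⊢
      exact hy.tail hac
    · exact Finset.mem_filter.mpr ⟨Finset.mem_univ _, .single hac⟩
    · simpa using hd.2 a
  · rintro ⟨r, hr⟩
    have key : ∀ a c, Relation.TransGen (fun a b => d a b = true) a c → r a < r c := by
      intro a c h
      induction h with
      | single h => exact hr _ _ h
      | tail _ h ih => exact ih.trans (hr _ _ h)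
    refine ⟨fun v => ?_, fun v hv => (key v v hv).false⟩
    by_contra hv
    exact (hr v v (by simpa using hv)).false

theorem Covered.isDAG_reverseEdge {n : ℕ} {d : Dir n} {v w : Fin n} (h : Covered d v w)
    (hd : IsDAG d) : IsDAG (CausalMEC.reverseEdge d v w) := by
  obtain ⟨r, hr⟩ := isDAG_iff_exists_rank.mp hd
  refine isDAG_iff_exists_rank.mpr
    ⟨fun x => if x = v then 2 * r v + 1 else if x = w then 2 * r v else 2 * r x, fun a c hac => ?_⟩
  have hvw := hr _ _ h.edge
  have hne := h.ne
  have hpar := h.parents_eq a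
  have hvv := hd.1 v
  have hww := hd.1 w
  have hac' := hr a c
  have hav := hr a v
  simp only [CausalMEC.reverseEdge] at hac
  grind

/-- Reachability survives the reversal of a covered edge `v → w`: while the walk stays in `{v, w}`,
one only needs to know whether it came in from a common parent of `v` and `w`, or else started at,
or came in from a child of, some `s ∈ {v, w}`. -/
theorem Covered.exists_walkReach_reverseEdge {n : ℕ} {d : Dir n} {v w : Fin n}
    (h : Covered d v w) {Z : Finset (Fin n)} {u x : Fin n} (hu : u ∉ Z)
    {p : Bool} (hx : WalkReach d Z u (x, p)) :
    ∃ q, WalkReach (CausalMEC.reverseEdge d v w) Z u (x, q) := by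
  have hne := h.ne
  have hwv : CausalMEC.reverseEdge d v w w v = true := by simp [CausalMEC.reverseEdge, hne]
  have heq : ∀ a c, ¬ ((a = v ∨ a = w) ∧ (c = v ∨ c = w)) →
      CausalMEC.reverseEdge d v w a c = d a c := by
    intro a c hac
    simp only [CausalMEC.reverseEdge]
    grind
  have hpar := h.parents_eq
  have hfwd : ∀ a q c, WalkReach (CausalMEC.reverseEdge d v w) Z u (a, q) → a ∉ Z →
      CausalMEC.reverseEdge d v w a c = true →
      WalkReach (CausalMEC.reverseEdge d v w) Z u (c, true) := fun _ _ _ h => h.fwd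
  have hbwd : ∀ a q c, WalkReach (CausalMEC.reverseEdge d v w) Z u (a, q) →
      (a ∈ Z ↔ q = true) → CausalMEC.reverseEdge d v w c a = true →
      WalkReach (CausalMEC.reverseEdge d v w) Z u (c, false) := fun _ _ _ h => h.bwd
  have hstart : WalkReach (CausalMEC.reverseEdge d v w) Z u (u, false) := Relation.ReflTransGen.refl
  generalize CausalMEC.reverseEdge d v w = d' at *
  have key : ∀ t, WalkReach d Z u t →
      (t.1 ≠ v ∧ t.1 ≠ w ∧ WalkReach d' Z u (t.1, t.2)) ∨
      ((t.1 = v ∨ t.1 = w) ∧ WalkReach d' Z u (v, true) ∧ WalkReach d' Z u (w, true) ∧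
        (t.2 = false → v ∈ Z ∨ w ∈ Z)) ∨
      ((t.1 = v ∨ t.1 = w) ∧ ∃ s, (s = v ∨ s = w) ∧ WalkReach d' Z u (s, false) ∧
        (s ∉ Z ∨ t.1 = s ∧ t.2 = false)) := by
    intro t ht
    induction ht with
    | refl => grind
    | @tail b c _ hbc ih =>
      obtain ⟨b, q⟩ := b
      obtain ⟨c, q'⟩ := c
      simp only [WalkStep] at hbc ih ⊢
      by_cases hc : c = v ∨ c = w
      · rcases ih with ⟨hbv, hbw, hb⟩ | ⟨hb, hv, hw, hZ⟩ | ⟨hb, s, hs, hr, hsZ⟩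
        · rcases hbc with ⟨hq, hbZ, hbc⟩ | ⟨hq, hbZ, hcb⟩
          · have hv : d' b v = true := by grind
            have hw : d' b w = true := by grind
            exact Or.inr (Or.inl ⟨hc, hfwd _ _ _ hb hbZ hv, hfwd _ _ _ hb hbZ hw, by simp [hq]⟩)
          · have hcb' : d' c b = true := by grind
            exact Or.inr (Or.inr ⟨hc, c, hc, hbwd _ _ _ hb hbZ hcb', Or.inr ⟨rfl, hq⟩⟩)
        · exact Or.inr (Or.inl ⟨hc, hv, hw, by grind⟩)
        · exact Or.inr (Or.inr ⟨hc, s, hs, hr, by grind⟩)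
      · refine Or.inl ⟨by grind, by grind, ?_⟩
        rcases ih with ⟨hbv, hbw, hb⟩ | ⟨hb, hv, hw, hZ⟩ | ⟨hb, s, hs, hr, hsZ⟩
        · grind
        · rcases hbc with ⟨rfl, hbZ, hbc⟩ | ⟨rfl, hbZ, hcb⟩
          · have : d' b c = true := by grind
            grind
          · have hcv : d' c v = true := by grind
            have hcw : d' c w = true := by grind
            grind
        · have hsZ' : s ∉ Z := by grind
          rcases hbc with ⟨rfl, hbZ, hbc⟩ | ⟨rfl, hbZ, hcb⟩
          · have : d' b c = true := by grind
            by_cases hbs : b = s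
            · grind
            · have : d' s b = true ∨ d' b s = true := by grind
              have : ∃ q, WalkReach d' Z u (b, q) := by grind
              grind
          · have : d' c s = true := by grind
            grind
  rcases key _ hx with ⟨-, -, hr⟩ | ⟨hxvw, hv, hw, -⟩ | ⟨hxvw, s, hs, hr, hsZ⟩
  · exact ⟨_, hr⟩
  · grind
  · by_cases hxs : x = s
    · grind
    · have : d' s x = true ∨ d' x s = true := by grind
      grind

theorem Covered.markovEquivD_reverseEdge {n : ℕ} {d : Dir n} {v w : Fin n}
    (h : Covered d v w) : MarkovEquivD d (CausalMEC.reverseEdge d v w) := by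
  intro a c Z _ ha hc
  rw [dConn_iff_exists_walkReach ha, dConn_iff_exists_walkReach ha]
  constructor
  · rintro ⟨p, hp⟩
    exact h.exists_walkReach_reverseEdge ha hp
  · rintro ⟨p, hp⟩
    simpa only [h.reverseEdge_reverseEdge] using
      h.reverseEdge.exists_walkReach_reverseEdge ha hp

/-! ### Reversing the edges of a matching -/

/-- Reverse all edges in `T`. -/
def reverseEdges {n : ℕ} (d : Dir n) (T : Finset (Fin n × Fin n)) : Dir n :=
  fun a c => if (a, c) ∈ T then false else if (c, a) ∈ T then true else d a c

theorem reverseEdges_insert {n : ℕ} (d : Dir n) (T : Finset (Fin n × Fin n)) (e : Fin n × Fin n)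
    (he : e.swap ∉ T) :
    reverseEdges d (insert e T) = reverseEdge (reverseEdges d T) e.1 e.2 := by
  obtain ⟨v, w⟩ := e
  funext a c
  simp only [reverseEdges, reverseEdge, Finset.mem_insert, Prod.mk.injEq, Prod.swap] at he ⊢
  grind

/-- The parents of a vertex incident to no edge of `T` are unaffected by reversing `T`. -/
theorem reverseEdges_apply_of_forall_ne {n : ℕ} (d : Dir n) {T : Finset (Fin n × Fin n)}
    {c : Fin n} (hc : ∀ e ∈ T, c ≠ e.1 ∧ c ≠ e.2) (a : Fin n) : reverseEdges d T a c = d a c := by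
  have h1 : (a, c) ∉ T := fun h => (hc _ h).2 rfl
  have h2 : (c, a) ∉ T := fun h => (hc _ h).1 rfl
  simp [reverseEdges, h1, h2]

/-- Observation 3.1: if `S` is a matching of reversible edges of a DAG `d`,
then `|MEC(d)| ≥ 2 ^ |S|`. -/
theorem matching_mec_lower_bound (n : ℕ) (d : Dir n) (hd : IsDAG d)
    (S : Finset (Fin n × Fin n))
    (hrev : ∀ e ∈ S, Reversible d e.1 e.2)
    (hmatch : ∀ e ∈ S, ∀ e' ∈ S, e ≠ e' →
      e.1 ≠ e'.1 ∧ e.1 ≠ e'.2 ∧ e.2 ≠ e'.1 ∧ e.2 ≠ e'.2) :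
    2 ^ S.card ≤ (MECdag d).ncard := by
  have hcov : ∀ e ∈ S, Covered d e.1 e.2 := fun e he => (hrev e he).covered hd
  have hswap : ∀ e ∈ S, e.swap ∉ S := fun e he he' =>
    (hmatch e he _ he' fun h => (hcov e he).ne (Prod.ext_iff.mp h).1).2.1 rfl
  have hmem : ∀ T ⊆ S, reverseEdges d T ∈ MECdag d := by
    intro T
    induction T using Finset.induction_on with
    | empty =>
      intro _
      have : reverseEdges d ∅ = d := by
        funext a c
        simp [reverseEdges]
      rw [this]
      exact ⟨hd, fun _ _ _ _ _ _ => Iff.rfl⟩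
    | insert e T heT ih =>
      intro hT
      have heS : e ∈ S := hT (Finset.mem_insert_self e T)
      have hTS : T ⊆ S := (Finset.subset_insert e T).trans hT
      obtain ⟨hdag, hm⟩ := ih hTS
      have hdisj : ∀ e' ∈ T, _ := fun e' he' =>
        hmatch e heS e' (hTS he') (fun h => heT (h ▸ he'))
      have h1 := reverseEdges_apply_of_forall_ne d (T := T) (c := e.1)
        fun e' he' => ⟨(hdisj e' he').1, (hdisj e' he').2.1⟩
      have h2 := reverseEdges_apply_of_forall_ne d (T := T) (c := e.2)
        fun e' he' => ⟨(hdisj e' he').2.2.1, (hdisj e' he').2.2.2⟩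
      have hc := hcov e heS
      have hc' : Covered (reverseEdges d T) e.1 e.2 :=
        ⟨hc.ne, (h2 _).trans hc.edge, (h1 _).trans hc.not_edge, fun x hx hx' => by
          rw [h1, h2, hc.parents_eq x hx hx']⟩
      rw [reverseEdges_insert d T e fun h => hswap e heS (hTS h)]
      exact ⟨hc'.isDAG_reverseEdge hdag, hm.trans (hc'.markovEquivD_reverseEdge)⟩
  have hiff : ∀ T ⊆ S, ∀ e ∈ S, e ∈ T ↔ reverseEdges d T e.1 e.2 = false := by
    intro T hT e he
    have h2 : (e.2, e.1) ∉ T := fun h => hswap e he (hT h)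
    simp [reverseEdges, h2, (hcov e he).edge]
  have hinj : Set.InjOn (reverseEdges d) (S.powerset : Set (Finset (Fin n × Fin n))) := by
    intro T hT T' hT' h
    have hT : T ⊆ S := by simpa using hT
    have hT' : T' ⊆ S := by simpa using hT'
    ext e
    by_cases he : e ∈ S
    · rw [hiff T hT e he, hiff T' hT' e he, h]
    · exact iff_of_false (fun h => he (hT h)) fun h => he (hT' h)
  rw [← Finset.card_powerset, ← Set.ncard_coe_finset, ← hinj.ncard_image]
  refine Set.ncard_le_ncard ?_ (Set.toFinite _)
  rintro _ ⟨T, hT, rfl⟩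
  exact hmem T (by simpa using hT)

end CausalMEC
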